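/- Let S be a term graph and p a position in S. If S is ⊐_p-minimal (i.e. there is no term graph T with S ⊐_p T), then the subgraph S↾p is maximally shared. -/

import Mathlib

namespace TermGraphs

/-- First-order terms over a signature `F` and variables `V`. -/
inductive Tm (F V : Type) : Type
  | var : V → Tm F V
  | app : F → List (Tm F V) → Tm F V

/-- A (pre-)graph over labels `L`: a finite set of nodes (drawn from `ℕ`),
a successor map assigning each node an ordered sequence of nodes,
a labelling, and a designated root node. -/
structure PreGraph (L : Type) where
  nodes : Finset ℕ
  suc : ℕ → List ℕ
  lab : ℕ → L
  root : ℕ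

variable {F V L : Type}

/-- The edge relation of a graph: `u → v` iff `v` occurs in `suc u`. -/
def Edge (G : PreGraph L) (u v : ℕ) : Prop := u ∈ G.nodes ∧ v ∈ G.suc u

/-- `v` is reachable from `u` in `G`. -/
def Reach (G : PreGraph L) : ℕ → ℕ → Prop := Relation.ReflTransGen (Edge G)

/-- `ReachesP G u p v`: starting in `u` and following the position `p`
(a sequence of argument indices) one reaches the node `v`. -/
inductive ReachesP (G : PreGraph L) : ℕ → List ℕ → ℕ → Prop
  | nil (u : ℕ) : ReachesP G u [] u
  | cons {u v w : ℕ} {i : ℕ} {p : List ℕ} :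
      u ∈ G.nodes → (G.suc u)[i]? = some v → ReachesP G v p w →
      ReachesP G u (i :: p) w

/-- `p` is a position of the node `u` in `G`, i.e. `p ∈ Pos_G(u)`. -/
def IsPos (G : PreGraph L) (u : ℕ) (p : List ℕ) : Prop := ReachesP G G.root p u

/-- A node is unshared if its set of positions is a singleton. -/
def Unshared (G : PreGraph L) (u : ℕ) : Prop := ∃! p, IsPos G u p

/-- A node `u` is strictly below the position `p` if `p` is a proper prefix of
some position of `u`. -/
def StrictlyBelow (G : PreGraph L) (p : List ℕ) (u : ℕ) : Prop :=
  ∃ q, IsPos G u q ∧ p <+: q ∧ p ≠ q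

open Classical in
/-- `S↾u`, the subgraph of `S` reachable from the node `u`. -/
noncomputable def subgraph (G : PreGraph L) (u : ℕ) : PreGraph L where
  nodes := G.nodes.filter fun v => Reach G u v
  suc := G.suc
  lab := G.lab
  root := u

/-- The union `G ∪ H` of two graphs (for properly sharing graphs this
is symmetric on the common nodes). -/
def gUnion (G H : PreGraph L) : PreGraph L where
  nodes := G.nodes ∪ H.nodes
  suc := fun u => if u ∈ G.nodes then G.suc u else H.suc u
  lab := fun u => if u ∈ G.nodes then G.lab u else H.lab u
  root := G.root

/-- Two graphs are properly sharing if every common node carries the same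
label and the same successor sequence in both. -/
def ProperlySharing (G H : PreGraph L) : Prop :=
  ∀ u, u ∈ G.nodes → u ∈ H.nodes → G.lab u = H.lab u ∧ G.suc u = H.suc u

/-- The redirection `G[u ≫ v]`: the node `u` is removed (and `v` added), and
`u` is replaced by `v` in all successor sequences. -/
def redirect (G : PreGraph L) (u v : ℕ) : PreGraph L where
  nodes := insert v (G.nodes.erase u)
  suc := fun w => (G.suc w).map fun x => if x = u then v else x
  lab := G.lab
  root := if G.root = u then v else G.root

/-- The replacement `G[u ← H]`: the subgraph of `G[u ≫ root(H)] ∪ H` reachable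
from `root(H)` if `u = root(G)`, and from `root(G)` otherwise. -/
noncomputable def replaceAt (G : PreGraph L) (u : ℕ) (H : PreGraph L) : PreGraph L :=
  subgraph (gUnion H (redirect G u H.root)) (if u = G.root then H.root else G.root)

/-- A term graph over the signature `F` (with arities `ar`) and variables `V`:
an acyclic rooted graph whose nodes are labelled by function symbols or
variables, such that a node labelled by `f` has `ar f` successors, a node
labelled by a variable has no successors, and variable nodes are shared. -/
structure IsTermGraph (ar : F → ℕ) (G : PreGraph (F ⊕ V)) : Prop where
  closed : ∀ u ∈ G.nodes, ∀ v ∈ G.suc u, v ∈ G.nodes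
  acyclic : ∀ u v : ℕ, Relation.TransGen (Edge G) u v → u ≠ v
  rootMem : G.root ∈ G.nodes
  rootReach : ∀ u ∈ G.nodes, Reach G G.root u
  funArity : ∀ u ∈ G.nodes, ∀ f : F, G.lab u = Sum.inl f → (G.suc u).length = ar f
  varSuc : ∀ u ∈ G.nodes, ∀ x : V, G.lab u = Sum.inr x → G.suc u = []
  varShared : ∀ u ∈ G.nodes, ∀ v ∈ G.nodes, ∀ x : V,
      G.lab u = Sum.inr x → G.lab v = Sum.inr x → u = v

/-- Fuelled computation of the term represented by (the subgraph at) a node.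
For a term graph, any fuel strictly exceeding the length of the longest
path suffices; acyclicity bounds path lengths by the number of nodes. -/
noncomputable def termAt [Inhabited V] (G : PreGraph (F ⊕ V)) : ℕ → ℕ → Tm F V
  | 0, _ => Tm.var default
  | fuel + 1, u =>
    match G.lab u with
    | Sum.inr x => Tm.var x
    | Sum.inl f => Tm.app f ((G.suc u).map fun v => termAt G fuel v)

/-- `term(G)`, the term represented by the term graph `G`. -/
noncomputable def termOf [Inhabited V] (G : PreGraph (F ⊕ V)) : Tm F V :=
  termAt G (G.nodes.card + 1) G.root

/-- Application of a substitution `σ : V → Tm F V` to a term. -/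
def substTm (σ : V → Tm F V) : Tm F V → Tm F V
  | Tm.var x => σ x
  | Tm.app f ts => Tm.app f (ts.attach.map fun t => substTm σ t.1)
decreasing_by
  have := List.sizeOf_lt_of_mem t.2
  simp only [Tm.app.sizeOf_spec]
  omega

/-- The variable `x` occurs in the term `t`. -/
inductive OccursIn (x : V) : Tm F V → Prop
  | var : OccursIn x (Tm.var x)
  | app {f : F} {ts : List (Tm F V)} {t : Tm F V} :
      t ∈ ts → OccursIn x t → OccursIn x (Tm.app f ts)

/-- A morphism `m : L → S` of term graphs: it maps nodes to nodes, root to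
root, and preserves labels and successor sequences at every node of `L`
labelled by a function symbol. -/
structure IsMorphism (L S : PreGraph (F ⊕ V)) (m : ℕ → ℕ) : Prop where
  maps : ∀ u ∈ L.nodes, m u ∈ S.nodes
  root : m L.root = S.root
  lab : ∀ u ∈ L.nodes, ∀ f : F, L.lab u = Sum.inl f → S.lab (m u) = Sum.inl f
  suc : ∀ u ∈ L.nodes, ∀ f : F, L.lab u = Sum.inl f → S.suc (m u) = (L.suc u).map m

/-- `S ≥_m T`: `m` is a morphism whose label and successor conditions hold at
*all* nodes of `S`, including variable nodes. -/
structure IsGeMorph (S T : PreGraph (F ⊕ V)) (m : ℕ → ℕ) : Prop where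
  maps : ∀ u ∈ S.nodes, m u ∈ T.nodes
  root : m S.root = T.root
  lab : ∀ u ∈ S.nodes, T.lab (m u) = S.lab u
  suc : ∀ u ∈ S.nodes, T.suc (m u) = (S.suc u).map m

open Classical in
/-- The substitution `σ_m` induced by a morphism `m : L → S`: a variable `x`
labelling the (unique) node `u` of `L` is mapped to `term(S↾m(u))`. -/
noncomputable def inducedSubst [Inhabited V] (L S : PreGraph (F ⊕ V)) (m : ℕ → ℕ) :
    V → Tm F V := fun x =>
  if h : ∃ u, u ∈ L.nodes ∧ L.lab u = Sum.inr x then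
    termOf (subgraph S (m h.choose))
  else Tm.var x

/-- `S ⊒_{u,v} T` (for nodes `u ≽ v` of `S`, taking `≻` to be the usual order
on `ℕ`): `S ≥_m T` for the morphism `m` with `m u = v` and `m w = w` for all
other nodes `w`. -/
def Collapse (S T : PreGraph (F ⊕ V)) (u v : ℕ) : Prop :=
  u ∈ S.nodes ∧ v ∈ S.nodes ∧ v ≤ u ∧
    IsGeMorph S T (fun w => if w = u then v else w)

/-- `S ⊐_{u,v} T`: `S ⊒_{u,v} T` with `u ≠ v`. -/
def CollapseS (S T : PreGraph (F ⊕ V)) (u v : ℕ) : Prop :=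
  Collapse S T u v ∧ u ≠ v

/-- The single-step folding relation `S ⊐ T`. -/
def Fold (S T : PreGraph (F ⊕ V)) : Prop := ∃ u v, CollapseS S T u v

/-- `S ⊐_p T`: `S` folds strictly below the position `p` to `T`. -/
def FoldBelow (p : List ℕ) (S T : PreGraph (F ⊕ V)) : Prop :=
  ∃ u v, CollapseS S T u v ∧ StrictlyBelow S p u ∧ StrictlyBelow S p v

/-- `S ▷_p T`: `S` unfolds above the position `p` to `T`, i.e. `T ⊐_{u,v} S`
for some node `u` of `T` that is unshared in `T` and whose unique position is
a prefix of `p`. -/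
def UnfoldAbove (p : List ℕ) (S T : PreGraph (F ⊕ V)) : Prop :=
  ∃ u v, CollapseS T S u v ∧ ∃ q, q <+: p ∧ (∀ q', IsPos T u q' ↔ q' = q)

/-- The relation `⊐` restricted to term graphs. -/
def FoldTG (ar : F → ℕ) (S T : PreGraph (F ⊕ V)) : Prop :=
  IsTermGraph ar S ∧ IsTermGraph ar T ∧ Fold S T

/-- The relation `⊐_p` restricted to term graphs. -/
def FoldBelowTG (ar : F → ℕ) (p : List ℕ) (S T : PreGraph (F ⊕ V)) : Prop :=
  IsTermGraph ar S ∧ IsTermGraph ar T ∧ FoldBelow p S T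

/-- The relation `▷_p` restricted to term graphs. -/
def UnfoldAboveTG (ar : F → ℕ) (p : List ℕ) (S T : PreGraph (F ⊕ V)) : Prop :=
  IsTermGraph ar S ∧ IsTermGraph ar T ∧ UnfoldAbove p S T

/-- `a →^! b` for an abstract relation `r`: `a r^* b` and `b` is `r`-minimal. -/
def NormTo {α : Type _} (r : α → α → Prop) (a b : α) : Prop :=
  Relation.ReflTransGen r a b ∧ ∀ c, ¬ r b c

/-- The `n`-fold composition of an abstract relation. -/
def Iter {α : Type _} (r : α → α → Prop) : ℕ → α → α → Prop
  | 0 => Eq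
  | n + 1 => fun a c => ∃ b, r a b ∧ Iter r n b c

/-- The node `u` of `G` is labelled by a variable. -/
def IsVarNode (G : PreGraph (F ⊕ V)) (u : ℕ) : Prop := ∃ x : V, G.lab u = Sum.inr x

/-- A graph rewrite rule `L → R`: `L` and `R` are properly sharing term
graphs, `root(L)` is not a variable node, every variable of `R` occurs in
`L`, and `root(L)` is not a node of `R`. -/
structure IsRule (ar : F → ℕ) (Lhs Rhs : PreGraph (F ⊕ V)) : Prop where
  lhs : IsTermGraph ar Lhs
  rhs : IsTermGraph ar Rhs
  sharing : ProperlySharing Lhs Rhs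
  rootNotVar : ¬ IsVarNode Lhs Lhs.root
  varsSub : ∀ x : V, (∃ u ∈ Rhs.nodes, Rhs.lab u = Sum.inr x) →
      (∃ u ∈ Lhs.nodes, Lhs.lab u = Sum.inr x)
  rootNotInRhs : Lhs.root ∉ Rhs.nodes

/-- `m(R)`: the graph obtained from `R` by replacing every node `v` in the
domain `dom` of the morphism `m` by `m v`; the replaced nodes keep the labels
and successor sequences they have in `S`. -/
def applyMorph (dom : Finset ℕ) (m : ℕ → ℕ) (S R : PreGraph (F ⊕ V)) :
    PreGraph (F ⊕ V) where
  nodes := R.nodes.image fun v => if v ∈ dom then m v else v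
  suc := fun w => if w ∈ S.nodes then S.suc w
                  else (R.suc w).map fun x => if x ∈ dom then m x else x
  lab := fun w => if w ∈ S.nodes then S.lab w else R.lab w
  root := if R.root ∈ dom then m R.root else R.root

/-- `φ` exhibits `G'` as an isomorphic copy of `G`. -/
structure GIsoOn (φ : ℕ → ℕ) (G G' : PreGraph (F ⊕ V)) : Prop where
  nodes : G'.nodes = G.nodes.image φ
  root : φ G.root = G'.root
  lab : ∀ u ∈ G.nodes, G'.lab (φ u) = G.lab u
  suc : ∀ u ∈ G.nodes, G'.suc (φ u) = (G.suc u).map φ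

/-- `L' → R'` is a renaming of the rule `L → R` with respect to `S`: an
isomorphic copy that is node-disjoint from `S`. -/
def IsRenaming (L R L' R' S : PreGraph (F ⊕ V)) : Prop :=
  ∃ φ : ℕ → ℕ, Set.InjOn φ ↑(L.nodes ∪ R.nodes) ∧
    GIsoOn φ L L' ∧ GIsoOn φ R R' ∧ Disjoint (L'.nodes ∪ R'.nodes) S.nodes

/-- `S ⇒_{G,u} T`: a graph rewrite step at the node `u`, using a renaming
`L' → R'` of some rule of `G`, a morphism `m : L' → S↾u`, and
`T = S[u ← m(R')]`. -/
def GStepAt (G : Set (PreGraph (F ⊕ V) × PreGraph (F ⊕ V))) (u : ℕ)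
    (S T : PreGraph (F ⊕ V)) : Prop :=
  ∃ LR ∈ G, ∃ L' R' : PreGraph (F ⊕ V), ∃ m : ℕ → ℕ,
    IsRenaming LR.1 LR.2 L' R' S ∧
    IsMorphism L' (subgraph S u) m ∧
    T = replaceAt S u (applyMorph L'.nodes m S R')

/-- `S ⇒_{G,p} T`: a graph rewrite step at the node corresponding to the
position `p`. -/
def GStepP (G : Set (PreGraph (F ⊕ V) × PreGraph (F ⊕ V))) (p : List ℕ)
    (S T : PreGraph (F ⊕ V)) : Prop :=
  ∃ u, IsPos S u p ∧ GStepAt G u S T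

/-- A term rewrite system: a finite set of rules `l → r` where `l` is not a
variable and every variable of `r` occurs in `l`. -/
def IsTRS (R : Set (Tm F V × Tm F V)) : Prop :=
  R.Finite ∧ ∀ lr ∈ R, (∀ x : V, lr.1 ≠ Tm.var x) ∧
    ∀ x : V, OccursIn x lr.2 → OccursIn x lr.1

/-- `s →_{R,p} t`: a rewrite step of the TRS `R` at position `p`. -/
inductive RewriteAt (R : Set (Tm F V × Tm F V)) : List ℕ → Tm F V → Tm F V → Prop
  | root {l r : Tm F V} (σ : V → Tm F V) :
      (l, r) ∈ R → RewriteAt R [] (substTm σ l) (substTm σ r)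
  | congr {i : ℕ} {p : List ℕ} {f : F} {ts : List (Tm F V)} {t t' : Tm F V} :
      ts[i]? = some t → RewriteAt R p t t' →
      RewriteAt R (i :: p) (Tm.app f ts) (Tm.app f (ts.set i t'))

/-- A graph is minimally sharing if every node is a variable node or unshared. -/
def MinimallySharing (G : PreGraph (F ⊕ V)) : Prop :=
  ∀ u ∈ G.nodes, IsVarNode G u ∨ Unshared G u

/-- A graph is maximally sharing if distinct nodes represent distinct terms. -/
def MaximallySharing [Inhabited V] (G : PreGraph (F ⊕ V)) : Prop :=
  ∀ u ∈ G.nodes, ∀ v ∈ G.nodes,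
    termOf (subgraph G u) = termOf (subgraph G v) → u = v

/-- `G ∈ Tree(s)`: `G` is a minimally sharing term graph representing `s`. -/
def InTree [Inhabited V] (ar : F → ℕ) (s : Tm F V) (G : PreGraph (F ⊕ V)) : Prop :=
  IsTermGraph ar G ∧ MinimallySharing G ∧ termOf G = s

/-- `G ∈ Shared(s)`: `G` is a maximally sharing term graph representing `s`. -/
def InShared [Inhabited V] (ar : F → ℕ) (s : Tm F V) (G : PreGraph (F ⊕ V)) : Prop :=
  IsTermGraph ar G ∧ MaximallySharing G ∧ termOf G = s

/-- `L → R` is a graph rewrite rule simulating the term rewrite rule `l → r`: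
`L ∈ Tree(l)`, `R ∈ Tree(r)` and the common nodes of `L` and `R` are exactly
the variable nodes of `R`. -/
def SimRule [Inhabited V] (ar : F → ℕ) (l r : Tm F V)
    (Lg Rg : PreGraph (F ⊕ V)) : Prop :=
  IsRule ar Lg Rg ∧ InTree ar l Lg ∧ InTree ar r Rg ∧
    ∀ w : ℕ, (w ∈ Lg.nodes ∧ w ∈ Rg.nodes) ↔ (w ∈ Rg.nodes ∧ IsVarNode Rg w)

/-- `G` is the simulating graph rewrite system `G(R)` of the TRS `R`. -/
def IsSimGRS [Inhabited V] (ar : F → ℕ) (R : Set (Tm F V × Tm F V))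
    (G : Set (PreGraph (F ⊕ V) × PreGraph (F ⊕ V))) : Prop :=
  (∀ lr ∈ R, ∃ LR ∈ G, SimRule ar lr.1 lr.2 LR.1 LR.2) ∧
  (∀ LR ∈ G, ∃ lr ∈ R, SimRule ar lr.1 lr.2 LR.1 LR.2)

/-- `S ⇒ˢ_{G,p} T`: `S ▷_p^! U`, `U ⊐_p^! V` and `V ⇒_{G,p} T` for some
term graphs `U`, `V`. -/
def SStepP (ar : F → ℕ) (G : Set (PreGraph (F ⊕ V) × PreGraph (F ⊕ V)))
    (p : List ℕ) (S T : PreGraph (F ⊕ V)) : Prop :=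
  ∃ U Vg : PreGraph (F ⊕ V),
    NormTo (UnfoldAboveTG ar p) S U ∧ NormTo (FoldBelowTG ar p) U Vg ∧
    GStepP G p Vg T

/-- `S ⇒ˢ_G T`: an `⇒ˢ`-step at some position. -/
def SStep (ar : F → ℕ) (G : Set (PreGraph (F ⊕ V) × PreGraph (F ⊕ V)))
    (S T : PreGraph (F ⊕ V)) : Prop :=
  ∃ p : List ℕ, SStepP ar G p S T

/-- `G` has a path of `n` edges. -/
def HasPathLen (G : PreGraph L) (n : ℕ) : Prop :=
  ∃ l : List ℕ, l.length = n + 1 ∧ l.Chain' (Edge G) ∧ ∀ x ∈ l, x ∈ G.nodes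

/-- The depth of `G`: the length of the longest path in `G`. -/
noncomputable def depth (G : PreGraph L) : ℕ := sSup {n | HasPathLen G n}

/-- Filling every hole of a context (a term over `F ∪ {□}`, the hole `□`
being represented by `none`) with the term `t`. -/
def fillAll (t : Tm F V) : Tm (Option F) V → Tm F V
  | Tm.var x => Tm.var x
  | Tm.app none _ => t
  | Tm.app (some f) ts => Tm.app f (ts.attach.map fun c => fillAll t c.1)
decreasing_by
  have := List.sizeOf_lt_of_mem c.2
  simp only [Tm.app.sizeOf_spec]
  omega

/-- Viewing a graph over `F ∪ V` as a graph over `(F ∪ {□}) ∪ V`. -/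
def relabel (G : PreGraph (F ⊕ V)) : PreGraph (Option F ⊕ V) where
  nodes := G.nodes
  suc := G.suc
  lab := fun u => Sum.map some id (G.lab u)
  root := G.root

/-- The one-node graph consisting of a hole node `h` labelled `□`. -/
def holeGraph (h : ℕ) : PreGraph (Option F ⊕ V) where
  nodes := {h}
  suc := fun _ => []
  lab := fun _ => Sum.inl none
  root := h

theorem ReachesP.append {G : PreGraph L} {u v w : ℕ} {p q : List ℕ}
    (h : ReachesP G u p v) (h' : ReachesP G v q w) : ReachesP G u (p ++ q) w := by
  induction h with
  | nil u => exact h'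
  | cons hu hi _ ih => exact .cons hu hi (ih h')

theorem Reach.exists_reachesP {G : PreGraph L} {u v : ℕ} (h : Reach G u v) :
    ∃ p, ReachesP G u p v := by
  induction h using Relation.ReflTransGen.head_induction_on with
  | refl => exact ⟨[], .nil _⟩
  | head hab _ ih =>
    obtain ⟨p, hp⟩ := ih
    obtain ⟨i, hi⟩ := List.mem_iff_getElem?.1 hab.2
    exact ⟨i :: p, .cons hab.1 hi hp⟩

theorem StrictlyBelow.of_reach {G : PreGraph L} {w u : ℕ} {p : List ℕ}
    (hw : IsPos G w p) (h : Reach G w u) (hne : u ≠ w) : StrictlyBelow G p u := by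
  obtain ⟨q, hq⟩ := h.exists_reachesP
  refine ⟨p ++ q, ReachesP.append hw hq, List.prefix_append p q, fun hpq => hne ?_⟩
  obtain rfl : q = [] := List.self_eq_append_right.1 hpq
  cases hq
  rfl

theorem mem_nodes_subgraph {G : PreGraph L} {u v : ℕ} :
    v ∈ (subgraph G u).nodes ↔ v ∈ G.nodes ∧ Reach G u v := by
  simp [subgraph]

theorem Reach.subgraph {G : PreGraph L} {w u v : ℕ} (hw : Reach G w u)
    (h : Reach G u v) : Reach (subgraph G w) u v := by
  induction h with
  | refl => exact .refl
  | tail hab hbc ih =>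
    exact ih.tail ⟨mem_nodes_subgraph.2 ⟨hbc.1, hw.trans hab⟩, hbc.2⟩

theorem termAt_subgraph {F V : Type} [Inhabited V] (G : PreGraph (F ⊕ V)) (w n u : ℕ) :
    termAt (subgraph G w) n u = termAt G n u := by
  induction n generalizing u with
  | zero => rfl
  | succ n ih =>
    simp only [termAt, ih]
    rfl

section IsTermGraph

variable {ar : F → ℕ} {G : PreGraph (F ⊕ V)}

theorem IsTermGraph.card_subgraph_lt (hG : IsTermGraph ar G) {u v : ℕ} (h : Edge G u v) :
    (subgraph G v).nodes.card < (subgraph G u).nodes.card := by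
  refine Finset.card_lt_card (Finset.ssubset_iff_of_subset ?_ |>.2 ⟨u, ?_, ?_⟩)
  · intro x hx
    rw [mem_nodes_subgraph] at hx ⊢
    exact ⟨hx.1, hx.2.head h⟩
  · exact mem_nodes_subgraph.2 ⟨h.1, .refl⟩
  · intro hu
    exact hG.acyclic u u (.head' h (mem_nodes_subgraph.1 hu).2) rfl

theorem card_subgraph_le (G : PreGraph (F ⊕ V)) (u : ℕ) :
    (subgraph G u).nodes.card ≤ G.nodes.card :=
  Finset.card_le_card fun _ hx => (mem_nodes_subgraph.1 hx).1

/-- The graph obtained from `G` by identifying the node `u` with the node `v`. -/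
def identify (G : PreGraph (F ⊕ V)) (u v : ℕ) : PreGraph (F ⊕ V) where
  nodes := G.nodes.erase u
  suc := fun x => (G.suc x).map fun y => if y = u then v else y
  lab := G.lab
  root := if G.root = u then v else G.root

theorem isGeMorph_identify {u v : ℕ} (hv : v ∈ G.nodes) (hne : u ≠ v)
    (hlab : G.lab u = G.lab v) (hsuc : G.suc u = G.suc v) :
    IsGeMorph G (identify G u v) (fun x => if x = u then v else x) where
  maps x hx := by
    dsimp only [identify]
    split_ifs with h
    · exact Finset.mem_erase.2 ⟨hne.symm, hv⟩
    · exact Finset.mem_erase.2 ⟨h, hx⟩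
  root := rfl
  lab x _ := by
    dsimp only [identify]
    split_ifs with h
    · rw [h, hlab]
    · rfl
  suc x _ := by
    dsimp only [identify]
    by_cases h : x = u
    · simp only [h, if_true, hsuc]
    · simp only [h, if_false]

variable [Inhabited V]

theorem IsTermGraph.termAt_eq_termAt (hG : IsTermGraph ar G) {m n u : ℕ} (hu : u ∈ G.nodes)
    (hm : (subgraph G u).nodes.card ≤ m) (hn : (subgraph G u).nodes.card ≤ n) :
    termAt G m u = termAt G n u := by
  have hpos : 0 < (subgraph G u).nodes.card :=
    Finset.card_pos.2 ⟨u, mem_nodes_subgraph.2 ⟨hu, .refl⟩⟩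
  induction m generalizing n u with
  | zero => omega
  | succ m ih =>
    obtain _ | n := n
    · omega
    simp only [termAt]
    cases G.lab u with
    | inr x => rfl
    | inl f =>
      simp only [Tm.app.injEq, true_and]
      refine List.map_congr_left fun v hv => ?_
      have hlt := hG.card_subgraph_lt ⟨hu, hv⟩
      have hvG := hG.closed u hu v hv
      exact ih hvG (by omega) (by omega)
        (Finset.card_pos.2 ⟨v, mem_nodes_subgraph.2 ⟨hvG, .refl⟩⟩)

/-- The term represented at a node of `G`. -/
noncomputable def nodeTerm (G : PreGraph (F ⊕ V)) (u : ℕ) : Tm F V :=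
  termAt G (G.nodes.card + 1) u

theorem IsTermGraph.nodeTerm_eq (hG : IsTermGraph ar G) {u : ℕ} (hu : u ∈ G.nodes) :
    nodeTerm G u = match G.lab u with
      | Sum.inr x => Tm.var x
      | Sum.inl f => Tm.app f ((G.suc u).map (nodeTerm G)) := by
  have h := card_subgraph_le G u
  rw [nodeTerm, hG.termAt_eq_termAt hu (by omega)
    (show (subgraph G u).nodes.card ≤ G.nodes.card + 1 + 1 by omega)]
  rfl

theorem IsTermGraph.termOf_subgraph_subgraph (hG : IsTermGraph ar G) {w u : ℕ}
    (hu : u ∈ (subgraph G w).nodes) :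
    termOf (subgraph (subgraph G w) u) = nodeTerm G u := by
  obtain ⟨huG, hwu⟩ := mem_nodes_subgraph.1 hu
  rw [termOf, termAt_subgraph, termAt_subgraph]
  change termAt G _ u = _
  have h := card_subgraph_le G u
  refine hG.termAt_eq_termAt huG (Nat.le_succ_of_le (Finset.card_le_card fun x hx => ?_))
    (by omega)
  obtain ⟨hxG, hux⟩ := mem_nodes_subgraph.1 hx
  exact mem_nodes_subgraph.2 ⟨mem_nodes_subgraph.2 ⟨hxG, hwu.trans hux⟩, hwu.subgraph hux⟩

theorem IsTermGraph.sizeOf_nodeTerm_lt (hG : IsTermGraph ar G) {u v : ℕ} (h : Edge G u v) :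
    sizeOf (nodeTerm G v) < sizeOf (nodeTerm G u) := by
  obtain ⟨hu, hv⟩ := h
  rw [hG.nodeTerm_eq hu]
  cases hl : G.lab u with
  | inr x => simp [hG.varSuc u hu x hl] at hv
  | inl f =>
    have := List.sizeOf_lt_of_mem (List.mem_map_of_mem (f := nodeTerm G) hv)
    simp only [Tm.app.sizeOf_spec]
    omega

theorem IsTermGraph.sizeOf_nodeTerm_lt_of_transGen (hG : IsTermGraph ar G) {u v : ℕ}
    (h : Relation.TransGen (Edge G) u v) :
    sizeOf (nodeTerm G v) < sizeOf (nodeTerm G u) := by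
  induction h with
  | single h => exact hG.sizeOf_nodeTerm_lt h
  | tail _ h ih => exact (hG.sizeOf_nodeTerm_lt h).trans ih

theorem IsTermGraph.identify (hG : IsTermGraph ar G) {u v : ℕ} (hv : v ∈ G.nodes) (hne : u ≠ v)
    (hlab : G.lab u = G.lab v) (hsuc : G.suc u = G.suc v)
    (hterm : nodeTerm G u = nodeTerm G v) : IsTermGraph ar (identify G u v) := by
  have hm := isGeMorph_identify hv hne hlab hsuc
  have hreach {a b : ℕ} (h : Reach G a b) : Reach (TermGraphs.identify G u v)
      (if a = u then v else a) (if b = u then v else b) := by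
    refine Relation.ReflTransGen.lift (fun x => if x = u then v else x) (fun x y hxy => ?_) _ _ h
    refine ⟨hm.maps x hxy.1, ?_⟩
    rw [hm.suc x hxy.1]
    exact List.mem_map_of_mem hxy.2
  have hsize {a b : ℕ} (h : Relation.TransGen (Edge (TermGraphs.identify G u v)) a b) :
      sizeOf (nodeTerm G b) < sizeOf (nodeTerm G a) := by
    have hedge {a b : ℕ} (h : Edge (TermGraphs.identify G u v) a b) :
        sizeOf (nodeTerm G b) < sizeOf (nodeTerm G a) := by
      obtain ⟨c, hc, rfl⟩ := List.mem_map.1 h.2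
      have := hG.sizeOf_nodeTerm_lt ⟨Finset.mem_of_mem_erase h.1, hc⟩
      split_ifs with hcu
      · rwa [← hterm, ← hcu]
      · exact this
    induction h with
    | single h => exact hedge h
    | tail _ h ih => exact (hedge h).trans ih
  constructor
  · intro a ha b hb
    obtain ⟨c, hc, rfl⟩ := List.mem_map.1 hb
    exact hm.maps c (hG.closed a (Finset.mem_of_mem_erase ha) c hc)
  · rintro a _ h rfl
    exact (hsize h).false
  · exact hm.maps _ hG.rootMem
  · intro a ha
    obtain ⟨hau, haG⟩ := Finset.mem_erase.1 ha
    have := hreach (hG.rootReach a haG)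
    rwa [if_neg hau] at this
  · intro a ha f hf
    exact (List.length_map _).trans (hG.funArity a (Finset.mem_of_mem_erase ha) f hf)
  · intro a ha x hx
    exact List.map_eq_nil_iff.2 (hG.varSuc a (Finset.mem_of_mem_erase ha) x hx)
  · intro a ha b hb
    exact hG.varShared a (Finset.mem_of_mem_erase ha) b (Finset.mem_of_mem_erase hb)

theorem IsTermGraph.exists_foldBelow (hG : IsTermGraph ar G) {p : List ℕ} {u v : ℕ}
    (hu : u ∈ G.nodes) (hv : v ∈ G.nodes) (hne : u ≠ v)
    (hup : StrictlyBelow G p u) (hvp : StrictlyBelow G p v)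
    (hlab : G.lab u = G.lab v) (hsuc : G.suc u = G.suc v)
    (hterm : nodeTerm G u = nodeTerm G v) :
    ∃ T : PreGraph (F ⊕ V), IsTermGraph ar T ∧ FoldBelow p G T := by
  wlog hle : v ≤ u generalizing u v
  · exact this hv hu hne.symm hvp hup hlab.symm hsuc.symm hterm.symm (by omega)
  exact ⟨_, hG.identify hv hne hlab hsuc hterm, u, v,
    ⟨⟨hu, hv, hle, isGeMorph_identify hv hne hlab hsuc⟩, hne⟩, hup, hvp⟩

end IsTermGraph

theorem eq_of_map_eq_map {α β : Type*} {f : α → β} {l l' : List α}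
    (h : l.map f = l'.map f) (hf : ∀ a ∈ l, ∀ b ∈ l', f a = f b → a = b) : l = l' := by
  induction l generalizing l' with
  | nil => simpa [eq_comm] using h
  | cons a l ih =>
    obtain _ | ⟨b, l'⟩ := l'
    · simp at h
    simp only [List.map_cons, List.cons.injEq] at h ⊢
    exact ⟨hf a (by simp) b (by simp) h.1,
      ih h.2 fun x hx y hy => hf x (by simp [hx]) y (by simp [hy])⟩

/-- If the term graph `S` is `⊐_p`-minimal, then the subgraph
`S↾p` is maximally shared. -/
theorem foldBelow_minimal_maximallySharing {F V : Type} [Inhabited V] (ar : F → ℕ)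
    (S : PreGraph (F ⊕ V)) (hS : IsTermGraph ar S)
    (p : List ℕ) (hp : ∃ w, IsPos S w p)
    (hmin : ¬ ∃ T : PreGraph (F ⊕ V), IsTermGraph ar T ∧ FoldBelow p S T) :
    ∀ w, IsPos S w p → MaximallySharing (subgraph S w) := by
  intro w hw u hu v hv huv
  rw [hS.termOf_subgraph_subgraph hu, hS.termOf_subgraph_subgraph hv] at huv
  rw [mem_nodes_subgraph] at hu hv
  induction hn : sizeOf (nodeTerm S u) using Nat.strong_induction_on generalizing u v with
  | _ n ih =>
  subst hn
  obtain ⟨huS, hwu⟩ := hu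
  obtain ⟨hvS, hwv⟩ := hv
  by_contra hne
  have ne_root {x y : ℕ} (hwy : Reach S w y) (hxy : x ≠ y)
      (h : nodeTerm S x = nodeTerm S y) : x ≠ w := by
    rintro rfl
    obtain hyx | hyx := Relation.reflTransGen_iff_eq_or_transGen.1 hwy
    · exact hxy hyx.symm
    · exact (h ▸ hS.sizeOf_nodeTerm_lt_of_transGen hyx).false
  have heq := huv
  rw [hS.nodeTerm_eq huS, hS.nodeTerm_eq hvS] at heq
  cases hlu : S.lab u with
  | inr x =>
    cases hlv : S.lab v with
    | inr y =>
      simp only [hlu, hlv, Tm.var.injEq] at heq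
      exact hne (hS.varShared u huS v hvS x hlu (heq ▸ hlv))
    | inl g => simp [hlu, hlv] at heq
  | inl f =>
    cases hlv : S.lab v with
    | inr y => simp [hlu, hlv] at heq
    | inl g =>
      simp only [hlu, hlv, Tm.app.injEq] at heq
      obtain ⟨rfl, hmap⟩ := heq
      have hsuc : S.suc u = S.suc v := eq_of_map_eq_map hmap
        fun a ha b hb hab => ih _ (hS.sizeOf_nodeTerm_lt ⟨huS, ha⟩)
          a ⟨hS.closed u huS a ha, hwu.tail ⟨huS, ha⟩⟩
          b ⟨hS.closed v hvS b hb, hwv.tail ⟨hvS, hb⟩⟩ hab rfl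
      exact hmin (hS.exists_foldBelow huS hvS hne
        (.of_reach hw hwu (ne_root hwv hne huv))
        (.of_reach hw hwv (ne_root hwu (Ne.symm hne) huv.symm))
        (hlu.trans hlv.symm) hsuc huv)

end TermGraphs
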